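/- For any shift-homogeneous metric space X and any ε ∈ ss(X), there is a coarse isomorphism f : X_ε × X/ε → X such that for each ε-connected component X_ε(x) ∈ X/ε the restriction of f to X_ε × {X_ε(x)} is an isometry from X_ε × {X_ε(x)} onto X_ε(x) ⊆ X. -/

import Mathlib

open scoped ENNReal symmDiff

noncomputable section

/-- The supremum in `ℕ∞` of a set of natural numbers. -/
def natSup (s : Set ℕ) : ℕ∞ := sSup ((↑) '' s : Set ℕ∞)

/-- The `ε`-connected component of a point `x`: all points linkable to `x` by a chain with
consecutive distances `≤ ε` (for `ε = ∞` this is the whole space). -/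
def comp (X : Type*) [MetricSpace X] (ε : ℝ≥0∞) (x : X) : Set X :=
  {y | Relation.ReflTransGen (fun a b => edist a b ≤ ε) x y}

/-- `ss X` is the set of `ε ∈ [0,∞]` such that for every finite `δ ≥ ε` and every point `x` the
set `{X_ε(y) : y ∈ X_δ(x)}` of `ε`-components of points of `X_δ(x)` is finite. -/
def ssSet (X : Type*) [MetricSpace X] : Set ℝ≥0∞ :=
  {ε | ∀ δ : ℝ≥0∞, δ ≠ ⊤ → ε ≤ δ → ∀ x : X, ((comp X ε) '' (comp X δ x)).Finite}

/-- The factorizing step `s(X) = inf ss(X)`. -/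
def sStep (X : Type*) [MetricSpace X] : ℝ≥0∞ := sInf (ssSet X)

/-- A metric space is boundedly-finite if every bounded subset is finite. -/
def BoundedlyFinite (X : Type*) [MetricSpace X] : Prop :=
  ∀ s : Set X, Bornology.IsBounded s → s.Finite

/-- A metric space is homogeneous if for any two points there is a bijective self-isometry
moving one to the other. -/
def Homogeneous (X : Type*) [MetricSpace X] : Prop :=
  ∀ x y : X, ∃ f : X ≃ᵢ X, f x = y

/-- A subset `C` is large scale connected if any two of its points can be linked by an
`ε`-chain for a common finite `ε`. -/
def IsLSCSet {X : Type*} [MetricSpace X] (C : Set X) : Prop :=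
  ∃ ε : ℝ≥0∞, ε ≠ ⊤ ∧ ∀ x ∈ C, ∀ y ∈ C, y ∈ comp X ε x

/-- A metric space is large scale connected if it coincides with an `ε`-connected component
for some finite `ε`. -/
def LargeScaleConnected (X : Type*) [MetricSpace X] : Prop :=
  ∃ ε : ℝ≥0∞, ε ≠ ⊤ ∧ ∀ x y : X, y ∈ comp X ε x

/-- A metric space is shift-homogeneous if any point can be moved to any other point by a
bijective self-isometry whose displacement is bounded on each large scale connected subset. -/
def ShiftHomogeneous (X : Type*) [MetricSpace X] : Prop :=
  ∀ x y : X, ∃ f : X ≃ᵢ X, f x = y ∧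
    ∀ C : Set X, IsLSCSet C → ∃ M : ℝ, ∀ c ∈ C, dist (f c) c ≤ M

/-- The oscillation `ω_f(δ) = sup {d (f x) (f x') : d x x' ≤ δ}` of a map, in `[0,∞]`. -/
def osc {X Y : Type*} [MetricSpace X] [MetricSpace Y] (f : X → Y) (δ : ℝ≥0∞) : ℝ≥0∞ :=
  ⨆ (x : X) (x' : X) (_ : edist x x' ≤ δ), edist (f x) (f x')

/-- A map between metric spaces is coarse if its oscillation at each finite `δ` is finite. -/
def CoarseMapM {X Y : Type*} [MetricSpace X] [MetricSpace Y] (f : X → Y) : Prop :=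
  ∀ δ : ℝ≥0∞, δ ≠ ⊤ → osc f δ ≠ ⊤

/-- Two metric spaces are coarsely isomorphic if there is a bijection between them which is
coarse in both directions. -/
def CoarselyIsomorphic (X Y : Type*) [MetricSpace X] [MetricSpace Y] : Prop :=
  ∃ f : X ≃ Y, CoarseMapM ⇑f ∧ CoarseMapM ⇑f.symm

/-- Two metric spaces are coarsely equivalent if there are coarse maps in both directions whose
compositions are within finite distance of the identities. -/
def CoarselyEquivalent (X Y : Type*) [MetricSpace X] [MetricSpace Y] : Prop :=
  ∃ f : X → Y, CoarseMapM f ∧ ∃ g : Y → X, CoarseMapM g ∧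
    (∃ M : ℝ, ∀ x : X, dist x (g (f x)) ≤ M) ∧ (∃ M : ℝ, ∀ y : Y, dist y (f (g y)) ≤ M)

/-- A metric on a group is left-invariant if left translations are isometries. -/
def LeftInvariantMetric (G : Type*) [Group G] [MetricSpace G] : Prop :=
  ∀ g x y : G, dist (g * x) (g * y) = dist x y

/-- A metric on a countable space is proper if all closed balls are finite. -/
def ProperMetric (X : Type*) [MetricSpace X] : Prop :=
  ∀ (x : X) (r : ℝ), (Metric.closedBall x r).Finite

/-- The space `X/ε` of `ε`-connected components of `X`. -/
def CompSpace (X : Type*) [MetricSpace X] (ε : ℝ≥0∞) : Type _ :=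
  {C : Set X // ∃ x : X, C = comp X ε x}

section Components

variable {X : Type*} [MetricSpace X] {δ ε : ℝ≥0∞} {x y z : X}

theorem edist_le_iff {Y : Type*} [PseudoMetricSpace Y] {a b : Y} {η : ℝ≥0∞} (h : η ≠ ⊤) :
    edist a b ≤ η ↔ dist a b ≤ η.toReal := by
  rw [edist_dist, ENNReal.ofReal_le_iff_le_toReal h]

theorem self_mem_comp : x ∈ comp X δ x := Relation.ReflTransGen.refl

theorem comp_mem_trans (h : y ∈ comp X δ x) (h' : z ∈ comp X δ y) : z ∈ comp X δ x :=
  Relation.ReflTransGen.trans h h'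

theorem comp_mem_symm (h : y ∈ comp X δ x) : x ∈ comp X δ y := by
  induction h with
  | refl => exact self_mem_comp
  | tail _ h ih =>
    exact comp_mem_trans (Relation.ReflTransGen.single (by simpa [edist_comm] using h)) ih

theorem mem_comp_of_edist_le (h : edist x y ≤ δ) : y ∈ comp X δ x :=
  Relation.ReflTransGen.single h

theorem comp_subset_comp (h : δ ≤ ε) (hy : y ∈ comp X δ x) : y ∈ comp X ε x := by
  induction hy with
  | refl => exact self_mem_comp
  | tail _ h' ih => exact comp_mem_trans ih (mem_comp_of_edist_le (h'.trans h))

theorem comp_eq_comp_iff : comp X δ x = comp X δ y ↔ y ∈ comp X δ x := by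
  refine ⟨fun h => h ▸ self_mem_comp, fun h => ?_⟩
  ext z
  exact ⟨comp_mem_trans (comp_mem_symm h), comp_mem_trans h⟩

theorem IsometryEquiv.map_mem_comp (g : X ≃ᵢ X) (h : y ∈ comp X δ x) :
    g y ∈ comp X δ (g x) := by
  induction h with
  | refl => exact self_mem_comp
  | tail _ h ih => exact comp_mem_trans ih (mem_comp_of_edist_le (by rwa [g.edist_eq]))

theorem isLSCSet_comp (h : δ ≠ ⊤) (x : X) : IsLSCSet (comp X δ x) :=
  ⟨δ, h, fun _ hy _ hz => comp_mem_trans (comp_mem_symm hy) hz⟩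

theorem finite_image_comp (hε : ε ∈ ssSet X) {δ' : ℝ≥0∞} (h : ε ≤ δ) (h' : ε ≤ δ')
    (hδ' : δ' ≠ ⊤) (x : X) : (comp X δ '' comp X δ' x).Finite := by
  have key : comp X δ '' comp X δ' x =
      (fun S : Set X => ⋃ y ∈ S, comp X δ y) '' (comp X ε '' comp X δ' x) := by
    rw [Set.image_image]
    refine Set.image_congr fun y _ => ?_
    ext z
    simp only [Set.mem_iUnion, exists_prop]
    exact ⟨fun hz => ⟨y, self_mem_comp, hz⟩,
      fun ⟨w, hw, hz⟩ => comp_mem_trans (comp_subset_comp h hw) hz⟩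
  rw [key]
  exact (hε δ' hδ' h' x).image _

theorem comp_zero (x : X) : comp X 0 x = {x} := by
  ext y
  refine ⟨fun h => ?_, fun h => h ▸ self_mem_comp⟩
  induction h with
  | refl => rfl
  | tail _ h ih => rw [← edist_le_zero.1 h]; exact ih

/-- The space between an isolated point and the rest of its `1`-component bounds the chains
starting at that point. -/
theorem exists_pos_comp_subset_singleton (h0 : (0 : ℝ≥0∞) ∈ ssSet X) (x : X) :
    ∃ r : ℝ≥0∞, 0 < r ∧ ∀ δ < r, comp X δ x ⊆ {x} := by
  have hfin : (comp X 1 x).Finite := by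
    have := h0 1 (by simp) (by simp) x
    refine Set.Finite.of_finite_image this fun a _ b _ hab => ?_
    simpa [comp_zero] using hab
  have hnhds : (comp X 1 x \ {x})ᶜ ∈ nhds x :=
    (hfin.subset Set.sdiff_subset).isClosed.isOpen_compl.mem_nhds (by simp)
  obtain ⟨r, hr, hball⟩ := EMetric.mem_nhds_iff.1 hnhds
  refine ⟨min r 1, lt_min hr one_pos, fun δ hδ y hy => ?_⟩
  induction hy with
  | refl => rfl
  | @tail b c _ h ih =>
    obtain rfl : b = x := ih
    by_contra hc
    refine hball (a := c) ?_ ⟨mem_comp_of_edist_le (h.trans (hδ.le.trans (min_le_right _ _))), hc⟩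
    rw [Metric.mem_eball, edist_comm]
    exact h.trans_lt (hδ.trans_le (min_le_left _ _))

end Components

section Quotient

variable {X : Type*} [MetricSpace X] {ε : ℝ≥0∞}

/-- The scales `δ ≥ ε` at which two `ε`-connected components merge. -/
def linkingScales (A B : CompSpace X ε) : Set ℝ≥0∞ :=
  {δ | ε ≤ δ ∧ ∃ x ∈ A.1, ∃ y ∈ B.1, x ∈ comp X δ y}

/-- The `ε`-connected component of a point, as an element of the space of components. -/
def toCompSpace (ε : ℝ≥0∞) (x : X) : CompSpace X ε := ⟨comp X ε x, x, rfl⟩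

theorem exists_toCompSpace_eq (A : CompSpace X ε) : ∃ x, toCompSpace ε x = A := by
  obtain ⟨_, x, rfl⟩ := A
  exact ⟨x, rfl⟩

theorem toCompSpace_eq_iff {x y : X} :
    toCompSpace ε x = toCompSpace ε y ↔ y ∈ comp X ε x :=
  Subtype.ext_iff.trans comp_eq_comp_iff

theorem mem_linkingScales_iff {x y : X} {δ : ℝ≥0∞} :
    δ ∈ linkingScales (toCompSpace ε x) (toCompSpace ε y) ↔ ε ≤ δ ∧ y ∈ comp X δ x := by
  refine and_congr_right fun hδ => ⟨?_, fun h =>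
    ⟨x, self_mem_comp, y, self_mem_comp, comp_mem_symm h⟩⟩
  rintro ⟨a, ha, b, hb, h⟩
  exact comp_mem_trans (comp_mem_trans (comp_subset_comp hδ ha) (comp_mem_symm h))
    (comp_mem_symm (comp_subset_comp hδ hb))

theorem linkingScales_comm (A B : CompSpace X ε) : linkingScales A B = linkingScales B A := by
  obtain ⟨x, rfl⟩ := exists_toCompSpace_eq A
  obtain ⟨y, rfl⟩ := exists_toCompSpace_eq B
  ext δ
  simp only [mem_linkingScales_iff]
  exact and_congr_right fun _ => ⟨comp_mem_symm, comp_mem_symm⟩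

theorem max_mem_linkingScales (x y : X) :
    max ε (edist x y) ∈ linkingScales (toCompSpace ε x) (toCompSpace ε y) :=
  mem_linkingScales_iff.2 ⟨le_max_left _ _, mem_comp_of_edist_le (le_max_right _ _)⟩

theorem ne_top_of_toCompSpace_ne {x y : X} (h : toCompSpace ε x ≠ toCompSpace ε y) : ε ≠ ⊤ := by
  rintro rfl
  exact h (toCompSpace_eq_iff.2 (mem_comp_of_edist_le le_top))

theorem sInf_linkingScales_ne_top {A B : CompSpace X ε} (h : A ≠ B) :
    sInf (linkingScales A B) ≠ ⊤ := by
  obtain ⟨x, rfl⟩ := exists_toCompSpace_eq A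
  obtain ⟨y, rfl⟩ := exists_toCompSpace_eq B
  exact ne_top_of_le_ne_top (max_lt (ne_top_of_toCompSpace_ne h).lt_top (edist_lt_top x y)).ne
    (sInf_le (max_mem_linkingScales x y))

theorem sInf_linkingScales_ne_zero (hε : ε ∈ ssSet X) {A B : CompSpace X ε} (h : A ≠ B) :
    sInf (linkingScales A B) ≠ 0 := by
  obtain rfl | hpos := eq_or_ne ε 0
  · obtain ⟨x, rfl⟩ := exists_toCompSpace_eq A
    obtain ⟨y, rfl⟩ := exists_toCompSpace_eq B
    obtain ⟨r, hr, hsub⟩ := exists_pos_comp_subset_singleton hε x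
    intro h0
    obtain ⟨δ, hδ, hlt⟩ := sInf_lt_iff.1 (h0.symm ▸ hr)
    have : y = x := hsub δ hlt (mem_linkingScales_iff.1 hδ).2
    exact h (by rw [this])
  · intro h0
    have : ε ≤ sInf (linkingScales A B) := le_sInf fun δ hδ => hδ.1
    exact hpos (by simpa [h0] using this)

theorem sInf_linkingScales_triangle (A B C : CompSpace X ε) :
    sInf (linkingScales A C) ≤ sInf (linkingScales A B) + sInf (linkingScales B C) := by
  obtain ⟨x, rfl⟩ := exists_toCompSpace_eq A
  obtain ⟨y, rfl⟩ := exists_toCompSpace_eq B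
  obtain ⟨z, rfl⟩ := exists_toCompSpace_eq C
  rw [ENNReal.sInf_add]
  refine le_iInf₂ fun δ hδ => ?_
  rw [ENNReal.add_sInf]
  refine le_iInf₂ fun δ' hδ' => ?_
  rw [mem_linkingScales_iff] at hδ hδ'
  refine sInf_le (mem_linkingScales_iff.2 ⟨hδ.1.trans le_self_add, ?_⟩)
  exact comp_mem_trans (comp_subset_comp le_self_add hδ.2) (comp_subset_comp le_add_self hδ'.2)

open Classical in
/-- The ultrametric on the space of `ε`-connected components. -/
@[reducible] def compSpaceMetric (hε : ε ∈ ssSet X) : MetricSpace (CompSpace X ε) where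
  dist A B := if A = B then 0 else (sInf (linkingScales A B)).toReal
  dist_self A := if_pos rfl
  dist_comm A B := by simp only [eq_comm (a := A), linkingScales_comm A B]
  dist_triangle A B C := by
    by_cases hAC : A = C
    · rw [if_pos hAC]
      positivity
    by_cases hAB : A = B
    · subst hAB
      simp
    by_cases hBC : B = C
    · subst hBC
      simp
    rw [if_neg hAC, if_neg hAB, if_neg hBC,
      ← ENNReal.toReal_add (sInf_linkingScales_ne_top hAB) (sInf_linkingScales_ne_top hBC)]
    exact ENNReal.toReal_mono (ENNReal.add_ne_top.2
      ⟨sInf_linkingScales_ne_top hAB, sInf_linkingScales_ne_top hBC⟩)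
      (sInf_linkingScales_triangle A B C)
  eq_of_dist_eq_zero {A B} h := by
    by_contra hAB
    rw [if_neg hAB] at h
    exact (ENNReal.toReal_pos (sInf_linkingScales_ne_zero hε hAB)
      (sInf_linkingScales_ne_top hAB)).ne' h

theorem mem_comp_add_one_of_dist_le (hε : ε ∈ ssSet X) {δ : ℝ≥0∞} (hδ : δ ≠ ⊤) {x y : X}
    (h : (compSpaceMetric hε).dist (toCompSpace ε x) (toCompSpace ε y) ≤ δ.toReal)
    (hne : toCompSpace ε x ≠ toCompSpace ε y) : y ∈ comp X (δ + 1) x := by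
  have h' : (sInf (linkingScales (toCompSpace ε x) (toCompSpace ε y))).toReal ≤ δ.toReal := by
    exact (if_neg hne).symm.trans_le h
  rw [ENNReal.toReal_le_toReal (sInf_linkingScales_ne_top hne) hδ] at h'
  obtain ⟨η, hη, hlt⟩ :=
    sInf_lt_iff.1 (h'.trans_lt (ENNReal.lt_add_right hδ one_ne_zero))
  exact comp_subset_comp hlt.le (mem_linkingScales_iff.1 hη).2

theorem dist_toCompSpace_le (hε : ε ∈ ssSet X) {δ : ℝ≥0∞} (hδ : δ ≠ ⊤) {x y : X}
    (h : edist x y ≤ δ) :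
    (compSpaceMetric hε).dist (toCompSpace ε x) (toCompSpace ε y) ≤ (max ε δ).toReal := by
  by_cases hne : toCompSpace ε x = toCompSpace ε y
  · exact (if_pos hne).trans_le ENNReal.toReal_nonneg
  · refine (if_neg hne).trans_le ?_
    exact ENNReal.toReal_mono (max_lt (ne_top_of_toCompSpace_ne hne).lt_top hδ.lt_top).ne
      ((sInf_le (max_mem_linkingScales x y)).trans (max_le_max le_rfl h))

end Quotient

section Tower

variable {X : Type*} [MetricSpace X]

/-- Transport of a base component along a tower of components: at each level `m` one applies the
chosen isometry `γ` for the `δ m`-component of the target point. -/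
def towerIsometry (γ : Set X → X ≃ᵢ X) (δ : ℕ → ℝ≥0∞) : ℕ → X → X ≃ᵢ X
  | 0, _ => IsometryEquiv.refl X
  | m + 1, x => (towerIsometry γ δ m ((γ (comp X (δ m) x)).symm x)).trans (γ (comp X (δ m) x))

theorem towerIsometry_succ_apply (γ : Set X → X ≃ᵢ X) (δ : ℕ → ℝ≥0∞) (m : ℕ) (x a : X) :
    towerIsometry γ δ (m + 1) x a =
      γ (comp X (δ m) x) (towerIsometry γ δ m ((γ (comp X (δ m) x)).symm x) a) := rfl

variable {γ : Set X → X ≃ᵢ X} {δ : ℕ → ℝ≥0∞} {x₀ : X}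

theorem symm_apply_mem_comp (hγ : ∀ S : Set X, S.Nonempty → γ S x₀ ∈ S) (η : ℝ≥0∞) (x : X) :
    (γ (comp X η x)).symm x ∈ comp X η x₀ := by
  have h := hγ (comp X η x) ⟨x, self_mem_comp⟩
  simpa using (γ (comp X η x)).symm.map_mem_comp (comp_mem_symm h)

theorem towerIsometry_base_mem
    (hγ : ∀ S : Set X, S.Nonempty → γ S x₀ ∈ S) (m : ℕ) {x : X} (hx : x ∈ comp X (δ m) x₀) :
    towerIsometry γ δ m x x₀ ∈ comp X (δ 0) x := by
  induction m generalizing x with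
  | zero => exact comp_mem_symm hx
  | succ m ih =>
    have h := (γ (comp X (δ m) x)).map_mem_comp (ih (symm_apply_mem_comp hγ (δ m) x))
    simpa [towerIsometry_succ_apply] using h

theorem towerIsometry_congr (hδ : Monotone δ) (m : ℕ) {x y : X} (h : y ∈ comp X (δ 0) x) :
    towerIsometry γ δ m x = towerIsometry γ δ m y := by
  induction m generalizing x y with
  | zero => rfl
  | succ m ih =>
    have hc : comp X (δ m) x = comp X (δ m) y :=
      comp_eq_comp_iff.2 (comp_subset_comp (hδ m.zero_le) h)
    simp only [towerIsometry, hc]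
    rw [ih ((γ (comp X (δ m) y)).symm.map_mem_comp h)]

theorem towerIsometry_eq_of_le (hδ : Monotone δ)
    (hid : ∀ S : Set X, x₀ ∈ S → γ S = IsometryEquiv.refl X) {m k : ℕ} (hmk : m ≤ k) {x : X}
    (hx : x ∈ comp X (δ m) x₀) : towerIsometry γ δ k x = towerIsometry γ δ m x := by
  induction k, hmk using Nat.le_induction with
  | base => rfl
  | succ k hk ih =>
    rw [← ih]
    simp only [towerIsometry, hid _ (comp_mem_symm (comp_subset_comp (hδ hk) hx))]
    rfl

theorem exists_displacement_bound_towerIsometry (hδ : Monotone δ) (htop : ∀ n, δ n ≠ ⊤)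
    (hss : δ 0 ∈ ssSet X) (hγ : ∀ S : Set X, S.Nonempty → γ S x₀ ∈ S)
    (hγb : ∀ S C : Set X, IsLSCSet C → ∃ M : ℝ, ∀ c ∈ C, dist (γ S c) c ≤ M) (m : ℕ) :
    ∃ B : ℝ, ∀ x ∈ comp X (δ m) x₀, ∀ a ∈ comp X (δ 0) x₀,
      dist (towerIsometry γ δ m x a) a ≤ B := by
  induction m with
  | zero => exact ⟨0, fun x _ a _ => (dist_self a).le⟩
  | succ m ih =>
    obtain ⟨B, hB⟩ := ih
    choose D hD using fun S : Set X => hγb S _ (isLSCSet_comp (htop m) x₀)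
    obtain ⟨D', hD'⟩ := ((finite_image_comp hss (hδ m.zero_le) (hδ (m + 1).zero_le)
      (htop (m + 1)) x₀).image D).bddAbove
    refine ⟨D' + B, fun x hx a ha => ?_⟩
    have hs := symm_apply_mem_comp hγ (δ m) x
    have hb : towerIsometry γ δ m ((γ (comp X (δ m) x)).symm x) a ∈ comp X (δ m) x₀ :=
      comp_mem_trans (comp_mem_trans hs (comp_subset_comp (hδ m.zero_le)
        (towerIsometry_base_mem hγ m hs))) (comp_subset_comp (hδ m.zero_le)
          (IsometryEquiv.map_mem_comp _ ha))
    rw [towerIsometry_succ_apply]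
    refine (dist_triangle _ _ _).trans (add_le_add ((hD _ _ hb).trans ?_) (hB _ hs _ ha))
    exact hD' ⟨_, ⟨x, hx, rfl⟩, rfl⟩

theorem exists_dist_bound_towerIsometry (hδ : Monotone δ) (htop : ∀ n, δ n ≠ ⊤)
    (hss : δ 0 ∈ ssSet X) (hγ : ∀ S : Set X, S.Nonempty → γ S x₀ ∈ S)
    (hγb : ∀ S C : Set X, IsLSCSet C → ∃ M : ℝ, ∀ c ∈ C, dist (γ S c) c ≤ M) (n : ℕ) :
    ∃ M : ℝ, ∀ m ≥ n, ∀ x ∈ comp X (δ m) x₀, ∀ y ∈ comp X (δ n) x, ∀ a ∈ comp X (δ 0) x₀,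
      dist (towerIsometry γ δ m x a) (towerIsometry γ δ m y a) ≤ M := by
  obtain ⟨B, hB⟩ := exists_displacement_bound_towerIsometry hδ htop hss hγ hγb n
  refine ⟨B + B, fun m hm => ?_⟩
  induction m, hm using Nat.le_induction with
  | base =>
    intro x hx y hy a ha
    exact (dist_triangle_right _ _ a).trans
      (add_le_add (hB x hx a ha) (hB y (comp_mem_trans hx hy) a ha))
  | succ m hm ih =>
    intro x hx y hy a ha
    have hc : comp X (δ m) y = comp X (δ m) x :=
      (comp_eq_comp_iff.2 (comp_subset_comp (hδ hm) hy)).symm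
    rw [towerIsometry_succ_apply, towerIsometry_succ_apply, hc, IsometryEquiv.dist_eq]
    exact ih _ (symm_apply_mem_comp hγ (δ m) x) _ (IsometryEquiv.map_mem_comp _ hy) a ha

end Tower

/-- In a shift-homogeneous space the `ε`-component of `x₀` can be moved to all the other
`ε`-components by isometries that stay uniformly close to each other on components which merge at
a given finite scale. -/
theorem ShiftHomogeneous.exists_coherent_isometries {X : Type*} [MetricSpace X]
    (hX : ShiftHomogeneous X) {ε : ℝ≥0∞} (hε : ε ∈ ssSet X) (x₀ : X) :
    ∃ F : X → X ≃ᵢ X, (∀ x, F x x₀ ∈ comp X ε x) ∧ (∀ x, ∀ y ∈ comp X ε x, F x = F y) ∧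
      ∀ δ : ℝ≥0∞, δ ≠ ⊤ → ∃ M : ℝ, ∀ x, ∀ y ∈ comp X δ x, ∀ a ∈ comp X ε x₀,
        dist (F x a) (F y a) ≤ M := by
  obtain rfl | htop := eq_or_ne ε ⊤
  · exact ⟨fun _ => IsometryEquiv.refl X, fun x => mem_comp_of_edist_le le_top, fun _ _ _ => rfl,
      fun _ _ => ⟨0, fun _ _ _ _ _ => by simp⟩⟩
  have hγ : ∀ S : Set X, ∃ g : X ≃ᵢ X, (S.Nonempty → g x₀ ∈ S) ∧
      (x₀ ∈ S → g = IsometryEquiv.refl X) ∧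
      ∀ C : Set X, IsLSCSet C → ∃ M : ℝ, ∀ c ∈ C, dist (g c) c ≤ M := by
    intro S
    by_cases h0 : x₀ ∈ S
    · exact ⟨IsometryEquiv.refl X, fun _ => h0, fun _ => rfl, fun _ _ => ⟨0, fun c _ => (dist_self c).le⟩⟩
    · obtain rfl | ⟨s, hs⟩ := S.eq_empty_or_nonempty
      · exact ⟨IsometryEquiv.refl X, by simp, fun _ => rfl, fun _ _ => ⟨0, fun c _ => (dist_self c).le⟩⟩
      · obtain ⟨g, hg, hb⟩ := hX x₀ s
        exact ⟨g, fun _ => hg ▸ hs, fun h => absurd h h0, hb⟩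
  choose γ hγ hid hγb using hγ
  let δ : ℕ → ℝ≥0∞ := fun n => ε + n
  have hδ0 : δ 0 = ε := by simp [δ]
  have hδ : Monotone δ := fun m n h => add_le_add le_rfl (by exact_mod_cast h)
  have hδtop : ∀ n, δ n ≠ ⊤ := fun n => by simp [δ, htop]
  have hunb : ∀ η : ℝ≥0∞, η ≠ ⊤ → ∃ n, η ≤ δ n := fun η hη => by
    obtain ⟨n, hn⟩ := ENNReal.exists_nat_gt hη
    exact ⟨n, hn.le.trans le_add_self⟩
  have hcover : ∀ x, ∃ m, x ∈ comp X (δ m) x₀ := fun x => by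
    obtain ⟨n, hn⟩ := hunb _ (edist_ne_top x₀ x)
    exact ⟨n, mem_comp_of_edist_le hn⟩
  choose m hm using hcover
  have hF : ∀ x k, m x ≤ k → towerIsometry γ δ (m x) x = towerIsometry γ δ k x :=
    fun x k hk => (towerIsometry_eq_of_le hδ hid hk (hm x)).symm
  rw [← hδ0] at hε ⊢
  refine ⟨fun x => towerIsometry γ δ (m x) x,
    fun x => towerIsometry_base_mem hγ _ (hm x), fun x y hy => ?_, fun η hη => ?_⟩
  · dsimp only
    rw [hF x _ (le_max_left _ (m y)), hF y _ (le_max_right (m x) _)]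
    exact towerIsometry_congr hδ _ hy
  · obtain ⟨n, hn⟩ := hunb η hη
    obtain ⟨M, hM⟩ := exists_dist_bound_towerIsometry hδ hδtop hε hγ hγb n
    refine ⟨M, fun x y hy a ha => ?_⟩
    let k := max n (max (m x) (m y))
    have hx : m x ≤ k := (le_max_left _ _).trans (le_max_right _ _)
    dsimp only
    rw [hF x k hx, hF y k ((le_max_right _ _).trans (le_max_right _ _))]
    exact hM k (le_max_left _ _) x (comp_subset_comp (hδ hx) (hm x)) y
      (comp_subset_comp hn hy) a ha

theorem coarseMapM_of_dist_le {X Y : Type*} [MetricSpace X] [MetricSpace Y] {f : X → Y}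
    (h : ∀ δ : ℝ≥0∞, δ ≠ ⊤ → ∃ M : ℝ, ∀ x x', edist x x' ≤ δ → dist (f x) (f x') ≤ M) :
    CoarseMapM f := by
  intro δ hδ
  obtain ⟨M, hM⟩ := h δ hδ
  refine ne_top_of_le_ne_top (ENNReal.ofReal_ne_top (r := M)) ?_
  refine iSup_le fun x => iSup_le fun x' => iSup_le fun hx => ?_
  rw [edist_dist]
  exact ENNReal.ofReal_le_ofReal (hM x x' hx)

/-- Theorem 4.1 (Factorization Theorem): for a shift-homogeneous metric space `X` and
`ε ∈ ss(X)` there is a coarse isomorphism `f : X_ε × X/ε → X` restricting to an isometry of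
`X_ε × {X_ε(x)}` onto `X_ε(x)` for each `ε`-connected component; here `X/ε` carries the
ultrametric `d(X_ε(x), X_ε(y)) = inf {δ ≥ ε : x ∈ X_δ(y)}` (and `0` on the diagonal). -/
theorem factorization_of_shift_homogeneous_space
    (X : Type*) [MetricSpace X] (hX : ShiftHomogeneous X)
    (ε : ℝ≥0∞) (hε : ε ∈ ssSet X) (x₀ : X) :
    ∃ dQ : MetricSpace (CompSpace X ε),
      (∀ A B : CompSpace X ε,
        (A = B → dQ.toPseudoMetricSpace.toDist.dist A B = 0) ∧
        (A ≠ B → dQ.toPseudoMetricSpace.toDist.dist A B =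
          (sInf {δ : ℝ≥0∞ | ε ≤ δ ∧ ∃ x ∈ A.1, ∃ y ∈ B.1, x ∈ comp X δ y}).toReal)) ∧
      ∃ f : (↥(comp X ε x₀) × CompSpace X ε) ≃ X,
        (@CoarseMapM _ _ (@Prod.metricSpaceMax _ _ _ dQ) _ ⇑f) ∧
        (@CoarseMapM _ _ _ (@Prod.metricSpaceMax _ _ _ dQ) ⇑f.symm) ∧
        ∀ Cc : CompSpace X ε,
          (∀ a b : ↥(comp X ε x₀), dist (f (a, Cc)) (f (b, Cc)) = dist (a : X) (b : X)) ∧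
          (∀ a : ↥(comp X ε x₀), f (a, Cc) ∈ Cc.1) ∧
          (∀ y ∈ Cc.1, ∃ a : ↥(comp X ε x₀), f (a, Cc) = y) := by
  let dQ : MetricSpace (CompSpace X ε) := compSpaceMetric hε
  obtain ⟨F, hF, hFc, hFM⟩ := hX.exists_coherent_isometries hε x₀
  have hmem : ∀ x, ∀ a ∈ comp X ε x₀, F x a ∈ comp X ε x := fun x a ha =>
    comp_mem_trans (hF x) ((F x).map_mem_comp ha)
  have hmem' : ∀ x, ∀ y ∈ comp X ε x, (F x).symm y ∈ comp X ε x₀ := fun x y hy => by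
    simpa using (F x).symm.map_mem_comp (comp_mem_trans (comp_mem_symm (hF x)) hy)
  choose r hr using fun A : CompSpace X ε => exists_toCompSpace_eq A
  have hrx : ∀ x, F (r (toCompSpace ε x)) = F x := fun x =>
    hFc _ _ (toCompSpace_eq_iff.1 (hr _))
  let f : (↥(comp X ε x₀) × CompSpace X ε) ≃ X :=
    { toFun := fun p => F (r p.2) p.1
      invFun := fun x => (⟨(F x).symm x, hmem' x x self_mem_comp⟩, toCompSpace ε x)
      left_inv := by
        rintro ⟨⟨a, ha⟩, A⟩
        have h := hmem (r A) a ha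
        ext
        · simp [← hFc _ _ h]
        · exact (toCompSpace_eq_iff.2 h).symm.trans (hr A)
      right_inv := fun x => by simp [hrx] }
  have hf : ∀ p, f p = F (r p.2) p.1 := fun p => rfl
  have hf2 : ∀ p, toCompSpace ε (f p) = p.2 := fun p =>
    congrArg Prod.snd (f.symm_apply_apply p)
  refine ⟨dQ, fun A B => ⟨fun h => if_pos h, fun h => if_neg h⟩, f, ?_, ?_, fun C => ⟨?_, ?_, ?_⟩⟩
  · refine coarseMapM_of_dist_le fun δ hδ => ?_
    obtain ⟨M, hM⟩ := hFM (δ + 1) (by simp [hδ])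
    refine ⟨δ.toReal + M, fun p q hpq => ?_⟩
    rw [Prod.edist_eq, max_le_iff, edist_le_iff hδ, edist_le_iff hδ] at hpq
    have hlink : r q.2 ∈ comp X (δ + 1) (r p.2) := by
      by_cases h : p.2 = q.2
      · rw [h]
        exact self_mem_comp
      · refine mem_comp_add_one_of_dist_le hε hδ ?_ ?_
        · rw [hr, hr]
          exact hpq.2
        · rwa [hr, hr]
    calc dist (f p) (f q) ≤ dist (F (r p.2) p.1) (F (r p.2) q.1)
          + dist (F (r p.2) q.1) (F (r q.2) q.1) := dist_triangle _ _ _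
      _ ≤ δ.toReal + M := by
        rw [IsometryEquiv.dist_eq]
        exact add_le_add hpq.1 (hM _ _ hlink _ q.1.2)
  · refine coarseMapM_of_dist_le fun δ hδ => ?_
    obtain ⟨M, hM⟩ := hFM δ hδ
    refine ⟨max (δ.toReal + M) (max ε δ).toReal, fun x y hxy => ?_⟩
    rw [Prod.dist_eq]
    refine max_le_max ?_ (dist_toCompSpace_le hε hδ hxy)
    have h := hM x y (mem_comp_of_edist_le hxy) _ (hmem' y y self_mem_comp)
    rw [IsometryEquiv.apply_symm_apply] at h
    have hd : dist x y ≤ δ.toReal := (edist_le_iff hδ).1 hxy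
    calc dist (f.symm x).1 (f.symm y).1 = dist ((F x).symm x) ((F y).symm y) := rfl
      _ = dist x (F x ((F y).symm y)) := by
        rw [← (F x).dist_eq, IsometryEquiv.apply_symm_apply]
      _ ≤ dist x y + dist y (F x ((F y).symm y)) := dist_triangle _ _ _
      _ ≤ δ.toReal + M := add_le_add hd (by rwa [dist_comm])
  · exact fun a b => (F (r C)).dist_eq a b
  · intro a
    have h := congrArg Subtype.val (hf2 (a, C))
    exact h ▸ (self_mem_comp : f (a, C) ∈ comp X ε (f (a, C)))
  · intro y hy
    have h : toCompSpace ε y = C := by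
      rw [← hr C] at hy ⊢
      exact (toCompSpace_eq_iff.2 hy).symm
    exact ⟨(f.symm y).1, h ▸ f.apply_symm_apply y⟩

end
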